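/- Σ_{k=0}^{∞} (w_k - [k ≥ 1]/(πk)) = (4/π) log 2, i.e. w_0 + Σ_{k=1}^{∞} (w_k - 1/(πk)) = (4 log 2)/π, where w_k = ((2k)!)^2/(2^{4k}(k!)^4). -/

import Mathlib

open Real

/-- The normalized central binomial coefficient. -/
noncomputable def bb (n : ℕ) : ℝ := ∏ i ∈ Finset.range n, (2 * (i : ℝ) + 1) / (2 * i + 2)

lemma bb_succ (n : ℕ) : bb (n+1) = bb n * ((2 * (n : ℝ) + 1) / (2 * n + 2)) := by
  exact Finset.prod_range_succ _ _

lemma bb_pos (n : ℕ) : 0 < bb n := by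
  unfold bb
  exact Finset.prod_pos fun i _ => by positivity

lemma bb_choose (n : ℕ) : Ring.choose (-(1/2) : ℝ) n = (-1)^n * bb n := by
  have h : ∀ n : ℕ, (n.factorial : ℝ) * ((-1)^n * bb n) = (descPochhammer ℤ n).smeval (-(1/2) : ℝ) := by
    intro n
    induction n with
    | zero => simp [bb]
    | succ n ih =>
      rw [descPochhammer_succ_right, Polynomial.smeval_mul, ← ih, bb_succ, Nat.factorial_succ]
      simp [Polynomial.smeval_natCast]
      field_simp
      ring
  have h1 := Ring.descPochhammer_eq_factorial_smul_choose (-(1/2) : ℝ) n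
  rw [← h n, nsmul_eq_mul] at h1
  have : (n.factorial : ℝ) ≠ 0 := by positivity
  exact (mul_left_cancel₀ this h1).symm

lemma bb_hasSum (y : ℝ) (hy : |y| < 1) : HasSum (fun n => bb n * y^n) (1 / √(1 - y)) := by
  have h := (Real.one_add_rpow_hasFPowerSeriesOnBall_zero (a := -(1/2))).hasSum (y := -y)
    (by simpa [enorm_eq_nnnorm] using! hy)
  simp only [binomialSeries_apply, bb_choose] at h
  have h2 : 0 ≤ 1 - y := by linarith [(abs_lt.1 hy).2]
  convert! h using 1
  · ext n
    simp
    rw [neg_pow y n]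
    have : ((-1:ℝ)^n * (-1)^n) = 1 := by rw [← mul_pow]; simp
    linear_combination (- bb n * y^n) * this
  · rw [zero_add, ← sub_eq_add_neg, rpow_neg h2, ← sqrt_eq_rpow, one_div]

lemma bb_fact (n : ℕ) : ((Nat.factorial (2 * n) : ℝ))^2 /
            (2 ^ (4 * n) * (Nat.factorial n : ℝ)^4) = bb n ^ 2 := by
  have h : ((Nat.factorial (2 * n) : ℝ)) = bb n * 2^(2*n) * (n.factorial : ℝ)^2 := by
    induction n with
    | zero => simp [bb]
    | succ n ih =>
      rw [show 2 * (n+1) = 2*n+1+1 by ring, Nat.factorial_succ, Nat.factorial_succ,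
        Nat.factorial_succ, bb_succ]
      push_cast
      rw [ih]
      field_simp
      ring
  rw [h]
  have : (n.factorial : ℝ) ≠ 0 := by positivity
  field_simp
  ring

lemma bb_odd (n : ℕ) : ∏ i ∈ Finset.range n, (2 * (i : ℝ) + 2) / (2 * i + 3) =
    1 / ((2 * n + 1) * bb n) := by
  induction n with
  | zero => simp [bb]
  | succ n ih =>
    rw [Finset.prod_range_succ, ih, bb_succ]
    have := (bb_pos n).ne'
    push_cast
    field_simp
    ring

lemma int_term (n : ℕ) : ∫ x in (0:ℝ)..(π/2), bb n * cos x ^ (2*n) * (1 - cos x) =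
    π / 2 * (bb n ^ 2) - 1 / (2 * n + 1) := by
  have : ∀ x : ℝ, bb n * cos x ^ (2*n) * (1 - cos x) =
      bb n * cos x ^ (2*n) - bb n * cos x ^ (2*n+1) := by intro x; ring
  simp_rw [this]
  rw [intervalIntegral.integral_sub (by apply Continuous.intervalIntegrable; fun_prop)
    (by apply Continuous.intervalIntegrable; fun_prop),
    intervalIntegral.integral_const_mul, intervalIntegral.integral_const_mul,
    EulerSine.integral_cos_pow_eq, EulerSine.integral_cos_pow_eq,
    integral_sin_pow_even, integral_sin_pow_odd, bb_odd]
  have := (bb_pos n).ne'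
  change bb n * (1/2 * (π * bb n)) - _ = _
  field_simp

lemma cos_facts {t : ℝ} (ht : t ∈ Set.uIoc 0 (π/2)) : 0 < sin t ∧ 0 ≤ cos t ∧ cos t < 1 := by
  rw [Set.uIoc_of_le (by positivity)] at ht
  have hs : 0 < sin t := sin_pos_of_pos_of_lt_pi ht.1 (by linarith [ht.2, pi_pos])
  have hc : 0 ≤ cos t := cos_nonneg_of_mem_Icc ⟨by linarith [ht.1, pi_pos], ht.2⟩
  exact ⟨hs, hc, by nlinarith [sin_sq_add_cos_sq t]⟩

lemma term_hasSum {t : ℝ} (ht : t ∈ Set.uIoc 0 (π/2)) :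
    HasSum (fun n => bb n * cos t ^ (2*n) * (1 - cos t)) (sin t / (1 + cos t)) := by
  obtain ⟨hs, hc, hc1⟩ := cos_facts ht
  have := (bb_hasSum (cos t ^ 2) (by rw [abs_of_nonneg (by positivity)]; nlinarith)).mul_right
    (1 - cos t)
  convert! this using 1
  · ext n; rw [pow_mul]
  · rw [← sin_sq, sqrt_sq hs.le]
    have : 1 + cos t ≠ 0 := by positivity
    field_simp
    nlinarith [sin_sq_add_cos_sq t]

lemma one_add_cos_ne {x : ℝ} (hx : x ∈ Set.uIcc 0 (π/2)) : 1 + cos x ≠ 0 := by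
  rw [Set.uIcc_of_le (by positivity)] at hx
  have : 0 ≤ cos x := cos_nonneg_of_mem_Icc ⟨by linarith [hx.1, pi_pos], hx.2⟩
  positivity

lemma int_g : IntervalIntegrable (fun t => sin t / (1 + cos t)) MeasureTheory.volume 0 (π/2) := by
  apply ContinuousOn.intervalIntegrable
  exact ContinuousOn.div (by fun_prop) (by fun_prop) fun x hx => one_add_cos_ne hx

lemma int_g_val : ∫ t in (0:ℝ)..(π/2), sin t / (1 + cos t) = log 2 := by
  rw [intervalIntegral.integral_eq_sub_of_hasDerivAt (f := fun t => - log (1 + cos t)) ?_ int_g]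
  · norm_num
  · intro x hx
    have := (((hasDerivAt_cos x).const_add 1).log (one_add_cos_ne hx)).neg
    convert! this using 1
    ring

lemma hasSum_A : HasSum (fun n : ℕ => π / 2 * (bb n ^ 2) - 1 / (2 * n + 1)) (log 2) := by
  rw [← int_g_val]
  simp_rw [← int_term]
  apply intervalIntegral.hasSum_integral_of_dominated_convergence
    (fun n t => bb n * cos t ^ (2*n) * (1 - cos t))
  · intro n
    apply Continuous.aestronglyMeasurable
    fun_prop
  · intro n
    refine Filter.Eventually.of_forall fun t ht => ?_
    obtain ⟨hs, hc, hc1⟩ := cos_facts ht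
    rw [norm_of_nonneg]
    have := bb_pos n
    have : 0 ≤ 1 - cos t := by linarith
    positivity
  · exact Filter.Eventually.of_forall fun t ht => (term_hasSum ht).summable
  · exact int_g.congr fun t ht => (term_hasSum ht).tsum_eq.symm
  · exact Filter.Eventually.of_forall fun t ht => term_hasSum ht

lemma hasSum_B : HasSum (fun n : ℕ => 1 / (2 * (n:ℝ) + 2) - 1 / (2 * n + 3)) (1 - log 2) := by
  rw [hasSum_iff_tendsto_nat_of_nonneg]
  swap
  · intro n
    rw [sub_nonneg]
    apply one_div_le_one_div_of_le <;> linarith [(Nat.cast_nonneg n : (0:ℝ) ≤ n)]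
  have hp : ∀ n : ℕ, ∑ k ∈ Finset.range n, (1 / (2 * (k:ℝ) + 2) - 1 / (2 * k + 3)) =
      (harmonic n : ℝ) - (harmonic (2*n) : ℝ) + 1 - 1 / (2 * n + 1) := by
    intro n
    induction n with
    | zero => simp
    | succ n ih =>
      rw [Finset.sum_range_succ, ih, show 2 * (n+1) = 2*n+1+1 by ring, harmonic_succ,
        harmonic_succ, harmonic_succ]
      push_cast
      field_simp
      ring
  have h1 := Real.tendsto_harmonic_sub_log
  have h2 := h1.comp (Filter.tendsto_id.const_mul_atTop' (r := 2) (by norm_num) : Filter.Tendsto (fun n : ℕ => 2 * n) Filter.atTop Filter.atTop)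
  have h3 : Filter.Tendsto (fun n : ℕ => 1 / (2 * (n:ℝ) + 1)) Filter.atTop (nhds 0) := by
    have := (tendsto_one_div_add_atTop_nhds_zero_nat (𝕜 := ℝ)).comp (Filter.tendsto_id.const_mul_atTop' (r := 2) (by norm_num) : Filter.Tendsto (fun n : ℕ => 2 * n) Filter.atTop Filter.atTop)
    refine this.congr fun n => ?_
    simp
  have h4 := (((h1.sub h2).add_const (1 - log 2)).sub h3)
  rw [sub_self, zero_add, sub_zero] at h4
  refine h4.congr' ?_
  filter_upwards [Filter.eventually_gt_atTop 0] with n hn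
  rw [hp]
  have : (n:ℝ) ≠ 0 := by positivity
  simp only [Function.comp]
  push_cast
  rw [log_mul (by norm_num) this]
  ring

theorem wk_series_log_two :
    (((Nat.factorial 0 : ℝ))^2 / (2 ^ 0 * (Nat.factorial 0 : ℝ)^4)) +
      (∑' k : ℕ,
        (((Nat.factorial (2 * (k + 1)) : ℝ))^2 /
            (2 ^ (4 * (k + 1)) * (Nat.factorial (k + 1) : ℝ)^4) -
          1 / (π * (k + 1)))) = 4 * Real.log 2 / π := by
  have hA := (hasSum_nat_add_iff' 1).2 hasSum_A
  have h := (hA.sub hasSum_B).mul_left (2 / π)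
  have h' : HasSum (fun k : ℕ => (((Nat.factorial (2 * (k + 1)) : ℝ))^2 /
            (2 ^ (4 * (k + 1)) * (Nat.factorial (k + 1) : ℝ)^4) -
          1 / (π * (k + 1)))) (4 * Real.log 2 / π - 1) := by
    convert! h using 1
    · ext k
      rw [bb_fact]
      push_cast
      have := pi_pos.ne'
      field_simp
      ring
    · have := pi_pos.ne'
      simp [bb]
      field_simp
      ring
  rw [h'.tsum_eq]
  simp
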